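/- For one-dimensional probability distributions P and Q with distribution functions F and G and finite p-th moments (p ≥ 1), the Wasserstein distance of order p satisfies d_{W,p}(P,Q) = (∫_0^1 |F^{-1}(t) − G^{-1}(t)|^p dt)^{1/p}, where F^{-1} and G^{-1} are the generalized inverse (quantile) functions. -/

import Mathlib

open MeasureTheory

/-- The Wasserstein distance of order `p` between two measures on `ℝ`:
the infimum of `(E |X - Y|^p)^(1/p)` over couplings `(X, Y)`. -/
noncomputable def dWp (p : ℝ) (P Q : Measure ℝ) : ℝ :=
  sInf {r : ℝ | ∃ μ : Measure (ℝ × ℝ), IsProbabilityMeasure μ ∧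
    μ.map Prod.fst = P ∧ μ.map Prod.snd = Q ∧
    r = (∫ z, |z.1 - z.2| ^ p ∂μ) ^ (1 / p)}

/-- The (generalized inverse) quantile function of a measure on `ℝ`:
`F⁻¹(t) = inf {x : t ≤ F(x)}` where `F(x) = P((-∞, x])`. -/
noncomputable def quantile (P : Measure ℝ) (t : ℝ) : ℝ :=
  sInf {x : ℝ | t ≤ (P (Set.Iic x)).toReal}

open ProbabilityTheory Set Filter Topology
open scoped ENNReal

lemma quantile_le_iff (P : Measure ℝ) [IsProbabilityMeasure P] {t : ℝ} (ht : t ∈ Ioo (0 : ℝ) 1)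
    (x : ℝ) : quantile P t ≤ x ↔ t ≤ cdf P x := by
  have hset : {x : ℝ | t ≤ (P (Iic x)).toReal} = {x | t ≤ cdf P x} := by
    ext y; simp [cdf_eq_real, Measure.real]
  rw [quantile, hset]
  obtain ⟨a, ha⟩ := ((tendsto_cdf_atBot P).eventually_lt_const ht.1).exists
  obtain ⟨b, hb⟩ := ((tendsto_cdf_atTop P).eventually_const_lt ht.2).exists
  have hlb : ∀ y, cdf P y < t → y ∈ lowerBounds {x | t ≤ cdf P x} := by
    intro y hy z hz
    by_contra! hzy
    exact absurd (hz.trans (monotone_cdf P hzy.le)) (not_le.2 hy)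
  refine ⟨fun h => ?_, fun h => csInf_le ⟨a, hlb a ha⟩ h⟩
  by_contra! hx
  have hcont : Tendsto (cdf P) (𝓝[>] x) (𝓝 (cdf P x)) :=
    ((cdf P).right_continuous x).mono_left (nhdsWithin_mono _ Ioi_subset_Ici_self)
  obtain ⟨y, hy, hxy⟩ := ((hcont.eventually_lt_const hx).and self_mem_nhdsWithin).exists
  have : y ≤ sInf {x | t ≤ cdf P x} := le_csInf ⟨b, hb.le⟩ (hlb y hy)
  exact absurd (this.trans h) (not_le.2 hxy)

lemma monotoneOn_quantile (P : Measure ℝ) [IsProbabilityMeasure P] :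
    MonotoneOn (quantile P) (Ioo 0 1) := fun _ hs _ ht hst =>
  (quantile_le_iff P hs _).2 (hst.trans ((quantile_le_iff P ht _).1 le_rfl))

lemma aemeasurable_quantile (P : Measure ℝ) [IsProbabilityMeasure P] :
    AEMeasurable (quantile P) (volume.restrict (Ioo 0 1)) :=
  aemeasurable_restrict_of_monotoneOn measurableSet_Ioo (monotoneOn_quantile P)

instance isProbabilityMeasure_volume_restrict_Ioo_zero_one :
    IsProbabilityMeasure (volume.restrict (Ioo (0 : ℝ) 1)) := ⟨by simp⟩

/-- The quantile function pushes the uniform distribution on `(0, 1)` forward to `P`. -/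
lemma map_quantile (P : Measure ℝ) [IsProbabilityMeasure P] :
    (volume.restrict (Ioo (0 : ℝ) 1)).map (quantile P) = P := by
  have := Measure.isProbabilityMeasure_map (aemeasurable_quantile P)
  refine Measure.ext_of_Iic _ _ fun x => ?_
  rw [Measure.map_apply_of_aemeasurable (aemeasurable_quantile P) measurableSet_Iic]
  have h1 : (quantile P ⁻¹' Iic x : Set ℝ) =ᵐ[volume.restrict (Ioo (0 : ℝ) 1)]
      Iic (cdf P x) := by
    filter_upwards [ae_restrict_mem measurableSet_Ioo] with t ht
    exact propext (quantile_le_iff P ht x)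
  have h2 : volume (Iic (cdf P x) ∩ Ioo (0 : ℝ) 1) = volume (Iic (cdf P x) ∩ Ioc (0 : ℝ) 1) :=
    measure_congr ((ae_eq_refl _).inter Ioo_ae_eq_Ioc)
  rw [measure_congr h1, Measure.restrict_apply measurableSet_Iic, h2, inter_comm, Ioc_inter_Iic,
    min_eq_right (cdf_le_one P x), Real.volume_Ioc, sub_zero, ofReal_cdf]

/-- The comonotone coupling of `P` and `Q`. -/
noncomputable def quantileCoupling (P Q : Measure ℝ) : Measure (ℝ × ℝ) :=
  (volume.restrict (Ioo (0 : ℝ) 1)).map fun t => (quantile P t, quantile Q t)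

section Coupling

variable (P Q : Measure ℝ) [IsProbabilityMeasure P] [IsProbabilityMeasure Q]

lemma aemeasurable_quantile_prodMk :
    AEMeasurable (fun t => (quantile P t, quantile Q t)) (volume.restrict (Ioo (0 : ℝ) 1)) :=
  (aemeasurable_quantile P).prodMk (aemeasurable_quantile Q)

instance : IsProbabilityMeasure (quantileCoupling P Q) :=
  Measure.isProbabilityMeasure_map (aemeasurable_quantile_prodMk P Q)

lemma map_fst_quantileCoupling : (quantileCoupling P Q).map Prod.fst = P := by
  rw [quantileCoupling, AEMeasurable.map_map_of_aemeasurable measurable_fst.aemeasurable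
    (aemeasurable_quantile_prodMk P Q)]
  exact map_quantile P

lemma map_snd_quantileCoupling : (quantileCoupling P Q).map Prod.snd = Q := by
  rw [quantileCoupling, AEMeasurable.map_map_of_aemeasurable measurable_snd.aemeasurable
    (aemeasurable_quantile_prodMk P Q)]
  exact map_quantile Q

lemma quantileCoupling_swap : (quantileCoupling P Q).map Prod.swap = quantileCoupling Q P := by
  rw [quantileCoupling, AEMeasurable.map_map_of_aemeasurable measurable_swap.aemeasurable
    (aemeasurable_quantile_prodMk P Q)]
  rfl

variable {P Q}

/-- Among all couplings, the comonotone one gives the least mass to products of a lower set and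
an upper set. -/
lemma quantileCoupling_prod_le {μ : Measure (ℝ × ℝ)} [IsProbabilityMeasure μ]
    (hP : μ.map Prod.fst = P) (hQ : μ.map Prod.snd = Q) {A B : Set ℝ}
    (hA : IsLowerSet A) (hB : IsUpperSet B) (hAm : MeasurableSet A) (hBm : MeasurableSet B) :
    quantileCoupling P Q (A ×ˢ B) ≤ μ (A ×ˢ B) := by
  by_cases hne : ∃ t ∈ Ioo (0 : ℝ) 1, quantile P t ∈ A ∧ quantile Q t ∈ B
  · obtain ⟨t, ht, htA, htB⟩ := hne
    have key : ∀ ν : Measure (ℝ × ℝ), IsProbabilityMeasure ν → ν.map Prod.fst = P →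
        ν.map Prod.snd = Q →
        P A + Q B = ν (Prod.fst ⁻¹' A ∪ Prod.snd ⁻¹' B) + ν (A ×ˢ B) := by
      rintro ν _ rfl rfl
      rw [Measure.map_apply measurable_fst hAm, Measure.map_apply measurable_snd hBm, Set.prod_eq,
        measure_union_add_inter _ (measurable_snd hBm)]
    have huniv : quantileCoupling P Q (Prod.fst ⁻¹' A ∪ Prod.snd ⁻¹' B) = 1 := by
      rw [← measure_univ (μ := quantileCoupling P Q)]
      refine measure_congr (eventuallyEq_univ.2 ?_)
      refine (ae_map_iff (aemeasurable_quantile_prodMk P Q)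
        ((measurable_fst hAm).union (measurable_snd hBm))).2 ?_
      filter_upwards [ae_restrict_mem measurableSet_Ioo] with s hs
      rcases le_total s t with hst | hst
      · exact Or.inl (hA (monotoneOn_quantile P hs ht hst) htA)
      · exact Or.inr (hB (monotoneOn_quantile Q ht hs hst) htB)
    have h1 := key _ inferInstance (map_fst_quantileCoupling P Q) (map_snd_quantileCoupling P Q)
    rw [huniv, key μ inferInstance hP hQ] at h1
    have h2 : 1 + quantileCoupling P Q (A ×ˢ B) ≤ 1 + μ (A ×ˢ B) := by
      rw [← h1]
      gcongr
      exact prob_le_one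
    exact (ENNReal.add_le_add_iff_left ENNReal.one_ne_top).1 h2
  · have : quantileCoupling P Q (A ×ˢ B) = 0 := by
      rw [quantileCoupling, Measure.map_apply_of_aemeasurable (aemeasurable_quantile_prodMk P Q)
        (hAm.prod hBm), measure_eq_zero_iff_ae_notMem]
      filter_upwards [ae_restrict_mem measurableSet_Ioo] with t ht hmem
      exact hne ⟨t, ht, hmem⟩
    simp [this]

end Coupling

/-- The region `{(s, r) : x ≤ s < y, 0 < r < p (y - s) ^ (p - 1)}`, whose area is
`(y - x)₊ ^ p`. -/
def powerRegion (p : ℝ) : Set ((ℝ × ℝ) × (ℝ × ℝ)) :=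
  {z | z.1.1 ≤ z.2.1 ∧ z.2.1 < z.1.2 ∧ 0 < z.2.2 ∧ z.2.2 < p * (z.1.2 - z.2.1) ^ (p - 1)}

lemma measurableSet_powerRegion (p : ℝ) : MeasurableSet (powerRegion p) := by
  simp only [powerRegion, ofPred_and]
  exact (measurableSet_le (by fun_prop) (by fun_prop)).inter
    ((measurableSet_lt (by fun_prop) (by fun_prop)).inter
    ((measurableSet_lt (by fun_prop) (by fun_prop)).inter
    (measurableSet_lt (by fun_prop) (by fun_prop))))

lemma volume_powerRegion_section {p : ℝ} (hp : 1 ≤ p) (x y : ℝ) :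
    volume (Prod.mk (x, y) ⁻¹' powerRegion p) = ENNReal.ofReal (max (y - x) 0 ^ p) := by
  rcases le_or_gt y x with h | h
  · have : Prod.mk (x, y) ⁻¹' powerRegion p = ∅ := by
      ext z
      simp only [powerRegion, mem_preimage, mem_ofPred_eq, mem_empty_iff_false, iff_false]
      rintro ⟨h1, h2, -⟩
      linarith
    rw [this, max_eq_right (by linarith), Real.zero_rpow (by linarith)]
    simp
  · have hreg : Prod.mk (x, y) ⁻¹' powerRegion p =
        regionBetween (fun _ => 0) (fun s => p * (y - s) ^ (p - 1)) (Ico x y) := by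
      ext z
      simp only [powerRegion, regionBetween, mem_preimage, mem_ofPred_eq, mem_Ico, mem_Ioo]
      tauto
    have hint : IntervalIntegrable (fun s => p * (y - s) ^ (p - 1)) volume x y :=
      (Continuous.const_mul (Continuous.rpow_const (by fun_prop) (by intros; right; linarith))
        _).intervalIntegrable _ _
    rw [hreg, Measure.volume_eq_prod, volume_regionBetween_eq_integral (by simp) ?_ measurableSet_Ico ?_,
      integral_Ico_eq_integral_Ioc, ← intervalIntegral.integral_of_le h.le]
    · simp only [Pi.sub_apply, sub_zero]
      rw [intervalIntegral.integral_const_mul,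
        intervalIntegral.integral_comp_sub_left (fun s => s ^ (p - 1)) y,
        integral_rpow (Or.inl (by linarith)), max_eq_left (by linarith)]
      simp only [sub_self, sub_add_cancel]
      rw [Real.zero_rpow (by linarith), sub_zero, mul_div_cancel₀ _ (by linarith)]
    · rwa [integrableOn_Ico_iff_integrableOn_Ioo, ← integrableOn_Ioc_iff_integrableOn_Ioo,
        ← intervalIntegrable_iff_integrableOn_Ioc_of_le h.le]
    · intro s hs
      have := Real.rpow_nonneg (sub_nonneg.2 hs.2.le) (p - 1)
      positivity

section Cost

variable {p : ℝ} {P Q : Measure ℝ} [IsProbabilityMeasure P] [IsProbabilityMeasure Q]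
  {μ : Measure (ℝ × ℝ)} [IsProbabilityMeasure μ]

lemma lintegral_posPart_rpow (hp : 1 ≤ p) (ν : Measure (ℝ × ℝ)) [IsProbabilityMeasure ν] :
    ∫⁻ z, ENNReal.ofReal (max (z.2 - z.1) 0 ^ p) ∂ν =
      ∫⁻ w, ν ((fun z => (z, w)) ⁻¹' powerRegion p) := by
  rw [← Measure.prod_apply_symm (measurableSet_powerRegion p),
    Measure.prod_apply (measurableSet_powerRegion p)]
  exact lintegral_congr fun z => (volume_powerRegion_section hp z.1 z.2).symm

lemma lintegral_posPart_quantileCoupling_le (hp : 1 ≤ p)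
    (hP : μ.map Prod.fst = P) (hQ : μ.map Prod.snd = Q) :
    ∫⁻ z, ENNReal.ofReal (max (z.2 - z.1) 0 ^ p) ∂(quantileCoupling P Q) ≤
      ∫⁻ z, ENNReal.ofReal (max (z.2 - z.1) 0 ^ p) ∂μ := by
  rw [lintegral_posPart_rpow hp, lintegral_posPart_rpow hp]
  refine lintegral_mono fun w => ?_
  have hsec : (fun z => (z, w)) ⁻¹' powerRegion p =
      Iic w.1 ×ˢ {y | w.1 < y ∧ 0 < w.2 ∧ w.2 < p * (y - w.1) ^ (p - 1)} := rfl
  simp only [hsec]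
  refine quantileCoupling_prod_le hP hQ (isLowerSet_Iic _) ?_ measurableSet_Iic ?_
  · rintro a b hab ⟨h1, h2, h3⟩
    refine ⟨h1.trans_le hab, h2, h3.trans_le ?_⟩
    have : 0 ≤ a - w.1 := by linarith
    have : 0 ≤ p - 1 := by linarith
    gcongr
  · simp only [ofPred_and]
    exact (measurableSet_lt (by fun_prop) (by fun_prop)).inter
      ((measurableSet_lt (by fun_prop) (by fun_prop)).inter
      (measurableSet_lt (by fun_prop) (by fun_prop)))

lemma lintegral_abs_sub_rpow (hp : 1 ≤ p) (ν : Measure (ℝ × ℝ)) :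
    ∫⁻ z, ENNReal.ofReal (|z.1 - z.2| ^ p) ∂ν =
      ∫⁻ z, ENNReal.ofReal (max (z.2 - z.1) 0 ^ p) ∂ν +
      ∫⁻ z, ENNReal.ofReal (max (z.2 - z.1) 0 ^ p) ∂(ν.map Prod.swap) := by
  rw [lintegral_map (by fun_prop) measurable_swap, ← lintegral_add_left (by fun_prop)]
  refine lintegral_congr fun z => ?_
  have h0 : (0 : ℝ) ^ p = 0 := Real.zero_rpow (by linarith)
  rcases le_total z.1 z.2 with h | h
  · rw [abs_of_nonpos (by linarith), max_eq_left (by linarith)]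
    simp [h, h0]
  · rw [abs_of_nonneg (by linarith), max_eq_right (by linarith)]
    simp [h, h0]

/-- The comonotone coupling minimizes the transport cost `|x - y| ^ p`. -/
lemma lintegral_quantileCoupling_le (hp : 1 ≤ p)
    (hP : μ.map Prod.fst = P) (hQ : μ.map Prod.snd = Q) :
    ∫⁻ z, ENNReal.ofReal (|z.1 - z.2| ^ p) ∂(quantileCoupling P Q) ≤
      ∫⁻ z, ENNReal.ofReal (|z.1 - z.2| ^ p) ∂μ := by
  have := Measure.isProbabilityMeasure_map (μ := μ) measurable_swap.aemeasurable
  rw [lintegral_abs_sub_rpow hp, lintegral_abs_sub_rpow hp, quantileCoupling_swap]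
  refine add_le_add (lintegral_posPart_quantileCoupling_le hp hP hQ)
    (lintegral_posPart_quantileCoupling_le hp ?_ ?_)
  · rw [Measure.map_map measurable_fst measurable_swap]; exact hQ
  · rw [Measure.map_map measurable_snd measurable_swap]; exact hP

end Cost

lemma integrable_abs_sub_rpow {p : ℝ} (hp : 1 ≤ p) {P Q : Measure ℝ} {μ : Measure (ℝ × ℝ)}
    (hPmom : Integrable (fun x => |x| ^ p) P) (hQmom : Integrable (fun x => |x| ^ p) Q)
    (hP : μ.map Prod.fst = P) (hQ : μ.map Prod.snd = Q) :
    Integrable (fun z : ℝ × ℝ => |z.1 - z.2| ^ p) μ := by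
  have hp0 : ENNReal.ofReal p ≠ 0 := by simp; linarith
  have hpr : (ENNReal.ofReal p).toReal = p := ENNReal.toReal_ofReal (by linarith)
  have hmem : ∀ R : Measure ℝ, Integrable (fun x => |x| ^ p) R →
      MemLp id (ENNReal.ofReal p) R := fun R hR => by
    refine (integrable_norm_rpow_iff aestronglyMeasurable_id hp0 ENNReal.ofReal_ne_top).1 ?_
    simpa [hpr] using hR
  subst hP hQ
  have h1 := (hmem _ hPmom).comp_of_map measurable_fst.aemeasurable
  have h2 := (hmem _ hQmom).comp_of_map measurable_snd.aemeasurable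
  simpa [hpr] using (h1.sub h2).integrable_norm_rpow hp0 ENNReal.ofReal_ne_top

theorem stmt19 (p : ℝ) (hp : 1 ≤ p) (P Q : Measure ℝ)
    [IsProbabilityMeasure P] [IsProbabilityMeasure Q]
    (hPmom : Integrable (fun x => |x| ^ p) P)
    (hQmom : Integrable (fun x => |x| ^ p) Q) :
    dWp p P Q =
      (∫ t in Set.Ioo (0 : ℝ) 1, |quantile P t - quantile Q t| ^ p) ^ (1 / p) := by
  have hcost : ∫ z, |z.1 - z.2| ^ p ∂(quantileCoupling P Q) =
      ∫ t in Ioo (0 : ℝ) 1, |quantile P t - quantile Q t| ^ p :=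
    integral_map (aemeasurable_quantile_prodMk P Q)
      (by fun_prop : Measurable fun z : ℝ × ℝ => |z.1 - z.2| ^ p).aestronglyMeasurable
  rw [← hcost]
  refine IsLeast.csInf_eq ⟨⟨_, inferInstance, map_fst_quantileCoupling P Q,
    map_snd_quantileCoupling P Q, rfl⟩, ?_⟩
  rintro _ ⟨μ, _, hP, hQ, rfl⟩
  refine Real.rpow_le_rpow (integral_nonneg fun _ => by positivity) ?_ (by positivity)
  rw [← ENNReal.ofReal_le_ofReal_iff (integral_nonneg fun _ => by positivity),
    ofReal_integral_eq_lintegral_ofReal (integrable_abs_sub_rpow hp hPmom hQmom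
      (map_fst_quantileCoupling P Q) (map_snd_quantileCoupling P Q))
      (ae_of_all _ fun _ => by positivity),
    ofReal_integral_eq_lintegral_ofReal (integrable_abs_sub_rpow hp hPmom hQmom hP hQ)
      (ae_of_all _ fun _ => by positivity)]
  exact lintegral_quantileCoupling_le hp hP hQ
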